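/- arXiv:1008.0538 — 4 statements merged into one kernel-verified Lean document; each statement's English description precedes it below -/
import Mathlib

section
/- Let k be an algebraically closed field and let K be a finitely generated field extension of k of transcendence degree 1 (a function field of dimension 1 over k). Then K is quasi-algebraically closed: for every N ≥ 1 and every homogeneous polynomial f in N variables over K of degree d with 1 ≤ d < N, there exists a nonzero vector a ∈ K^N with f(a) = 0. -/
namespace MvPolynomial

/-- Every maximal ideal of a polynomial ring over a field has height the number of variables. -/
theorem height_of_isMaximal {k σ : Type*} [Field k] [Finite σ]
    (M : Ideal (MvPolynomial σ k)) [M.IsMaximal] : M.height = Nat.card σ := by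
  induction σ using Finite.induction_empty_option with
  | of_equiv e ih =>
    have := Ideal.comap_isMaximal_of_equiv (renameEquiv k e) (p := M)
    rw [← RingEquiv.height_comap (renameEquiv k e).toRingEquiv M, ← Nat.card_congr e]
    exact ih _
  | h_empty =>
    have h := Ideal.height_le_ringKrullDim_of_ne_top (I := M) (Ideal.IsMaximal.ne_top ‹_›)
    simpa using h
  | @h_option σ _ ih =>
    let e := (optionEquivLeft k σ).symm
    have := Ideal.comap_isMaximal_of_equiv e (p := M)
    have hC := Polynomial.isMaximal_comap_C_of_isJacobsonRing (M.comap e)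
    rw [← RingEquiv.height_comap e.toRingEquiv M]
    let P : Ideal (Polynomial (MvPolynomial σ k)) := M.comap e
    change P.height = _
    have : P.LiesOver (P.under (MvPolynomial σ k)) := ⟨rfl⟩
    rw [Polynomial.height_eq_height_add_one (P.under (MvPolynomial σ k)) P]
    have : (P.under (MvPolynomial σ k)).IsMaximal := hC
    rw [ih]
    simp

/-- Over an algebraically closed field, fewer polynomials than variables, all without constant
term, have a common nonzero root. -/
theorem exists_ne_zero_forall_eval_eq_zero {k ι σ : Type*} [Field k] [IsAlgClosed k]
    [Finite ι] [Finite σ] (hcard : Nat.card ι < Nat.card σ) (F : ι → MvPolynomial σ k)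
    (hF : ∀ i, eval 0 (F i) = 0) : ∃ t : σ → k, t ≠ 0 ∧ ∀ i, eval t (F i) = 0 := by
  by_contra! H
  let M : Ideal (MvPolynomial σ k) := vanishingIdeal k {(0 : σ → k)}
  have hle : Ideal.span (Set.range F) ≤ M := by
    rw [Ideal.span_le]
    rintro _ ⟨i, rfl⟩
    simpa [M] using hF i
  obtain ⟨p, hp, hpM⟩ := Ideal.exists_minimalPrimes_le hle
  have : p.IsPrime := hp.1.1
  have hMp : M ≤ p := by
    rw [← IsPrime.vanishingIdeal_zeroLocus (K := k) p]
    apply vanishingIdeal_anti_mono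
    intro t ht
    by_contra h0
    obtain ⟨i, hi⟩ := H t h0
    exact hi (by simpa using ht _ (hp.1.2 (Ideal.subset_span ⟨i, rfl⟩)))
  obtain rfl : p = M := le_antisymm hpM hMp
  have h := Ideal.height_le_card_of_mem_minimalPrimes_span (Set.finite_range F) hp
  rw [height_of_isMaximal, Nat.cast_le] at h
  exact absurd (h.trans (Finite.card_range_le F)) (by simpa using hcard)

/-- A polynomial without constant term over an algebra `K` over an algebraically closed field `k`
has a nonzero root with coordinates in `k`, if its coefficients span a `k`-space of dimension less
than the number of variables. -/
theorem exists_ne_zero_eval_algebraMap_eq_zero {k K σ : Type*} [Field k] [IsAlgClosed k]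
    [CommRing K] [Algebra k K] [Finite σ] {V : Submodule k K} [Module.Finite k V]
    (hV : Module.finrank k V < Nat.card σ) {p : MvPolynomial σ K} (hp : p ∈ coeffsIn σ V)
    (hp0 : eval 0 p = 0) :
    ∃ t : σ → k, t ≠ 0 ∧ eval (fun i ↦ algebraMap k K (t i)) p = 0 := by
  have := Fintype.ofFinite σ
  let b := Module.finBasis k V
  let F (l : Fin (Module.finrank k V)) : MvPolynomial σ k :=
    ∑ m ∈ p.support, monomial m (b.repr ⟨p.coeff m, hp m⟩ l)
  have hF (t : σ → k) : eval (fun i ↦ algebraMap k K (t i)) p = ∑ l, eval t (F l) • (b l : K) := by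
    have hc (m) : p.coeff m = ∑ l, b.repr ⟨p.coeff m, hp m⟩ l • (b l : K) := by
      have h := congrArg V.subtype (b.sum_repr ⟨p.coeff m, hp m⟩)
      simpa only [map_sum, map_smul, Submodule.subtype_apply] using h.symm
    simp only [F, map_sum, eval_monomial, Finset.sum_smul]
    rw [Finset.sum_comm, eval_eq']
    refine Finset.sum_congr rfl fun m _ ↦ ?_
    conv_lhs => rw [hc m]
    simp only [Finset.sum_mul, Finsupp.prod_fintype, pow_zero, implies_true, Algebra.smul_def,
      map_mul, map_prod, map_pow]
    exact Finset.sum_congr rfl fun _ _ ↦ by ring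
  obtain ⟨t, ht, hFt⟩ := exists_ne_zero_forall_eval_eq_zero (by simpa using hV) F (by
    classical
    intro l
    rw [eval_zero, constantCoeff_eq] at hp0 ⊢
    have h0 : (⟨p.coeff 0, hp 0⟩ : V) = 0 := Subtype.ext hp0
    simp only [F, coeff_sum, coeff_monomial]
    exact Finset.sum_eq_zero fun m _ ↦ by split_ifs with hm <;> simp [hm, h0])
  exact ⟨t, ht, by simp [hF, hFt]⟩

end MvPolynomial

open IntermediateField

section BoundedDegree

variable {k K ι : Type*} [Field k] [Field K] [Algebra k K]

/-- The elements of `K` that are values at `x` of polynomials over `k` of degree at most `s`. -/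
def powersSpan (k : Type*) {K : Type*} [Field k] [Field K] [Algebra k K] (x : K) (s : ℕ) :
    Submodule k K :=
  Submodule.span k (Set.range fun i : Fin (s + 1) ↦ x ^ (i : ℕ))

theorem pow_mem_powersSpan (x : K) {i s : ℕ} (h : i ≤ s) : x ^ i ∈ powersSpan k x s :=
  Submodule.subset_span ⟨⟨i, Nat.lt_succ_of_le h⟩, rfl⟩

theorem powersSpan_mono (x : K) {s t : ℕ} (h : s ≤ t) : powersSpan k x s ≤ powersSpan k x t := by
  rw [powersSpan, Submodule.span_le]
  rintro _ ⟨i, rfl⟩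
  exact pow_mem_powersSpan x (by omega)

theorem powersSpan_mul_le (x : K) (s t : ℕ) :
    powersSpan k x s * powersSpan k x t ≤ powersSpan k x (s + t) := by
  rw [powersSpan, powersSpan, Submodule.span_mul_span, Submodule.span_le]
  rintro _ ⟨_, ⟨i, rfl⟩, _, ⟨j, rfl⟩, rfl⟩
  change x ^ (i : ℕ) * x ^ (j : ℕ) ∈ _
  rw [← pow_add]
  exact pow_mem_powersSpan x (by omega)

theorem one_le_powersSpan (x : K) (s : ℕ) : 1 ≤ powersSpan k x s := by
  rw [Submodule.one_le]
  simpa using pow_mem_powersSpan (k := k) x (Nat.zero_le s)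

theorem powersSpan_pow_le (x : K) (s d : ℕ) : powersSpan k x s ^ d ≤ powersSpan k x (s * d) := by
  induction d with
  | zero => simpa using one_le_powersSpan x 0
  | succ d ih =>
    rw [pow_succ]
    exact (mul_le_mul' ih le_rfl).trans (powersSpan_mul_le x _ _)

theorem aeval_mem_powersSpan (x : K) (p : Polynomial k) :
    Polynomial.aeval x p ∈ powersSpan k x p.natDegree := by
  rw [Polynomial.aeval_eq_sum_range]
  exact Submodule.sum_mem _ fun i hi ↦ Submodule.smul_mem _ _
    (pow_mem_powersSpan x (Nat.lt_succ_iff.mp (Finset.mem_range.mp hi)))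

theorem powersSpan_mul_span_range (x : K) (s : ℕ) (e : ι → K) :
    powersSpan k x s * Submodule.span k (Set.range e) =
      Submodule.span k (Set.range fun p : Fin (s + 1) × ι ↦ x ^ (p.1 : ℕ) * e p.2) := by
  rw [powersSpan, Submodule.span_mul_span]
  congr 1
  ext z
  simp [Set.mem_mul]

theorem finrank_powersSpan_mul_span_range_le [Fintype ι] (x : K) (s : ℕ) (e : ι → K) :
    Module.finrank k ↥(powersSpan k x s * Submodule.span k (Set.range e)) ≤
      (s + 1) * Fintype.card ι := by
  rw [powersSpan_mul_span_range]
  exact (finrank_range_le_card _).trans (by simp)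

theorem exists_aeval_mul_mem (x : K) (hx : Transcendental k x) (e : ι → K)
    (he : Submodule.span k⟮x⟯ (Set.range e) = ⊤) (z : K) :
    ∃ h : Polynomial k, h ≠ 0 ∧ ∃ c : ℕ,
      Polynomial.aeval x h * z ∈ powersSpan k x c * Submodule.span k (Set.range e) := by
  have hz : z ∈ Submodule.span k⟮x⟯ (Set.range e) := he ▸ Submodule.mem_top
  have key (h : Polynomial k) {w : K} {c : ℕ}
      (hw : w ∈ powersSpan k x c * Submodule.span k (Set.range e)) :
      Polynomial.aeval x h * w ∈
        powersSpan k x (h.natDegree + c) * Submodule.span k (Set.range e) := by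
    have := Submodule.mul_mem_mul (aeval_mem_powersSpan x h) hw
    rw [← mul_assoc] at this
    exact mul_le_mul' (powersSpan_mul_le x _ _) le_rfl this
  induction hz using Submodule.span_induction with
  | mem z hz =>
    exact ⟨1, one_ne_zero, 0, Submodule.mul_mem_mul
      (by simpa using one_le_powersSpan (k := k) x 0) (Submodule.subset_span hz)⟩
  | zero => exact ⟨1, one_ne_zero, 0, by simp⟩
  | add u v _ _ hu hv =>
    obtain ⟨p, hp, c, hu⟩ := hu
    obtain ⟨q, hq, c', hv⟩ := hv
    refine ⟨p * q, mul_ne_zero hp hq, max (q.natDegree + c) (p.natDegree + c'), ?_⟩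
    rw [mul_add]
    refine Submodule.add_mem _ ?_ ?_
    · rw [mul_comm p, map_mul, mul_assoc]
      exact mul_le_mul' (powersSpan_mono x (le_max_left _ _)) le_rfl (key q hu)
    · rw [map_mul, mul_assoc]
      exact mul_le_mul' (powersSpan_mono x (le_max_right _ _)) le_rfl (key p hv)
  | smul a u _ hu =>
    obtain ⟨p, hp, c, hu⟩ := hu
    obtain ⟨r, s, hrs⟩ := (mem_adjoin_simple_iff k (a : K)).mp a.2
    by_cases hs : s = 0
    · refine ⟨1, one_ne_zero, 0, ?_⟩
      rw [IntermediateField.smul_def, hrs, hs]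
      simp
    · refine ⟨s * p, mul_ne_zero hs hp, r.natDegree + c, ?_⟩
      convert key r hu using 1
      have : Polynomial.aeval x s ≠ 0 := fun h0 ↦
        hs (transcendental_iff_injective.mp hx (by simpa using h0))
      rw [IntermediateField.smul_def, hrs, map_mul, smul_eq_mul]
      field_simp

theorem exists_forall_aeval_mul_mem {τ : Type*} [Finite τ] (x : K) (hx : Transcendental k x)
    (e : ι → K) (he : Submodule.span k⟮x⟯ (Set.range e) = ⊤) (z : τ → K) :
    ∃ h : K, h ≠ 0 ∧ ∃ c : ℕ, ∀ i,
      h * z i ∈ powersSpan k x c * Submodule.span k (Set.range e) := by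
  classical
  have := Fintype.ofFinite τ
  choose h hh c hc using fun i ↦ exists_aeval_mul_mem x hx e he (z i)
  let q (i : τ) : Polynomial k := ∏ j ∈ Finset.univ.erase i, h j
  refine ⟨∏ i, Polynomial.aeval x (h i), ?_, ∑ i, ((q i).natDegree + c i), fun i ↦ ?_⟩
  · exact Finset.prod_ne_zero_iff.mpr fun i _ h0 ↦
      hh i (transcendental_iff_injective.mp hx (by simpa using h0))
  · have := Submodule.mul_mem_mul (aeval_mem_powersSpan x (q i)) (hc i)
    rw [← mul_assoc] at this
    rw [← map_prod, ← Finset.prod_erase_mul _ _ (Finset.mem_univ i), map_mul, mul_assoc]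
    refine mul_le_mul' ((powersSpan_mul_le x _ _).trans (powersSpan_mono x ?_)) le_rfl this
    exact Finset.single_le_sum (f := fun i ↦ (q i).natDegree + c i) (fun _ _ ↦ Nat.zero_le _)
      (Finset.mem_univ i)

theorem linearIndependent_pow_mul (x : K) (hx : Transcendental k x) {e : ι → K}
    (he : LinearIndependent k⟮x⟯ e) (s : ℕ) :
    LinearIndependent k fun p : Fin (s + 1) × ι ↦ x ^ (p.1 : ℕ) * e p.2 := by
  have h : LinearIndependent k fun i : Fin (s + 1) ↦ AdjoinSimple.gen k x ^ (i : ℕ) := by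
    refine LinearIndependent.of_comp k⟮x⟯.val.toLinearMap ?_
    have := ((Polynomial.basisMonomials k).linearIndependent.map'
      (Polynomial.aeval x).toLinearMap
      (LinearMap.ker_eq_bot.mpr (transcendental_iff_injective.mp hx))).comp
      (fun i : Fin (s + 1) ↦ (i : ℕ)) Fin.val_injective
    have heq : k⟮x⟯.val.toLinearMap ∘ (fun i : Fin (s + 1) ↦ AdjoinSimple.gen k x ^ (i : ℕ)) =
        ((Polynomial.aeval x).toLinearMap ∘ Polynomial.basisMonomials k) ∘
          fun i : Fin (s + 1) ↦ (i : ℕ) := by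
      ext i
      simp
    exact heq ▸ this
  exact linearIndependent_smul h he

end BoundedDegree

theorem Submodule.prod_pow_mem {k A τ : Type*} [CommSemiring k] [CommSemiring A] [Algebra k A]
    (W : Submodule k A) (s : Finset τ) (y : τ → A) (hy : ∀ i, y i ∈ W) (m : τ → ℕ) :
    ∏ i ∈ s, y i ^ m i ∈ W ^ ∑ i ∈ s, m i := by
  classical
  induction s using Finset.induction_on with
  | empty => simpa only [Finset.prod_empty, Finset.sum_empty, pow_zero] using
      Submodule.one_le.mp le_rfl
  | insert i s hi ih =>
    rw [Finset.prod_insert hi, Finset.sum_insert hi, pow_add]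
    exact Submodule.mul_mem_mul (Submodule.pow_mem_pow _ (hy i) _) ih

theorem span_singleton_pow_mul_pow_succ_le {k K : Type*} [Field k] [Field K] [Algebra k K]
    {x h : K} {c : ℕ} {E : Submodule k K}
    (hE : Submodule.span k {h} * (E * E) ≤ powersSpan k x c * E) (d : ℕ) :
    Submodule.span k {h} ^ d * E ^ (d + 1) ≤ powersSpan k x (c * d) * E := by
  induction d with
  | zero => simpa using mul_le_mul' (one_le_powersSpan (k := k) x 0) (le_refl E)
  | succ d ih =>
    calc Submodule.span k {h} ^ (d + 1) * E ^ (d + 1 + 1)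
        = Submodule.span k {h} * (Submodule.span k {h} ^ d * E ^ (d + 1)) * E := by ring
      _ ≤ Submodule.span k {h} * (powersSpan k x (c * d) * E) * E := by gcongr
      _ = powersSpan k x (c * d) * (Submodule.span k {h} * (E * E)) := by ring
      _ ≤ powersSpan k x (c * d) * (powersSpan k x c * E) := by gcongr
      _ = powersSpan k x (c * d) * powersSpan k x c * E := by ring
      _ ≤ powersSpan k x (c * (d + 1)) * E := by
        gcongr
        exact powersSpan_mul_le x _ _

/-- Substituting elements of bounded degree into a form over `K` gives, up to a common
denominator, a polynomial whose coefficients have bounded degree. -/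
theorem exists_C_mul_bind₁_mem_coeffsIn {k K ι τ : Type*} [Field k] [Field K] [Algebra k K]
    [Finite ι] {x : K} (hx : Transcendental k x) (e : ι → K)
    (he : Submodule.span k⟮x⟯ (Set.range e) = ⊤) {d : ℕ} {f : MvPolynomial τ K}
    (hf : f.IsHomogeneous d) :
    ∃ g : K, g ≠ 0 ∧ ∃ c : ℕ, ∀ {σ : Type*} (s : ℕ) (y : τ → MvPolynomial σ K),
      (∀ i, y i ∈ MvPolynomial.coeffsIn σ
        (powersSpan k x s * Submodule.span k (Set.range e))) →
      MvPolynomial.C g * MvPolynomial.bind₁ y f ∈ MvPolynomial.coeffsIn σ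
        (powersSpan k x (s * d + c) * Submodule.span k (Set.range e)) := by
  obtain ⟨h, hh, c, hc⟩ :=
    exists_forall_aeval_mul_mem x hx e he (fun p : ι × ι ↦ e p.1 * e p.2)
  obtain ⟨g, hg, b, hb⟩ :=
    exists_forall_aeval_mul_mem x hx e he (fun m : f.support ↦ f.coeff m)
  refine ⟨h ^ d * g, mul_ne_zero (pow_ne_zero d hh) hg, b + c * d, fun {σ} s y hy ↦ ?_⟩
  set E := Submodule.span k (Set.range e) with hEdef
  have hE : Submodule.span k {h} * (E * E) ≤ powersSpan k x c * E := by
    conv_lhs => rw [hEdef, Submodule.span_mul_span, Submodule.span_mul_span]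
    rw [Submodule.span_le]
    rintro _ ⟨_, rfl, _, ⟨_, ⟨i, rfl⟩, _, ⟨j, rfl⟩, rfl⟩, rfl⟩
    exact hc (i, j)
  have hle : Submodule.span k {h} ^ d * (powersSpan k x b * E) * (powersSpan k x s * E) ^ d ≤
      powersSpan k x (s * d + (b + c * d)) * E :=
    calc Submodule.span k {h} ^ d * (powersSpan k x b * E) * (powersSpan k x s * E) ^ d
        = powersSpan k x s ^ d * powersSpan k x b * (Submodule.span k {h} ^ d * E ^ (d + 1)) := by
          ring
      _ ≤ powersSpan k x (s * d) * powersSpan k x b * (powersSpan k x (c * d) * E) := by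
          exact mul_le_mul' (mul_le_mul' (powersSpan_pow_le x s d) le_rfl)
            (span_singleton_pow_mul_pow_succ_le hE d)
      _ = powersSpan k x (s * d) * (powersSpan k x b * powersSpan k x (c * d)) * E := by ring
      _ ≤ powersSpan k x (s * d + (b + c * d)) * E := by
          gcongr
          exact (mul_le_mul' le_rfl (powersSpan_mul_le x _ _)).trans (powersSpan_mul_le x _ _)
  rw [MvPolynomial.bind₁, MvPolynomial.aeval_def, MvPolynomial.eval₂_eq, Finset.mul_sum]
  refine Submodule.sum_mem _ fun m hm i ↦ hle ?_
  revert i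
  have hterm : MvPolynomial.C (h ^ d * g) * (algebraMap K (MvPolynomial σ K) (f.coeff m) *
      ∏ i ∈ m.support, y i ^ m i) =
      MvPolynomial.C (h ^ d) * MvPolynomial.C (g * f.coeff m) * ∏ i ∈ m.support, y i ^ m i := by
    simp only [MvPolynomial.algebraMap_eq, map_mul]
    ring
  rw [hterm, ← MvPolynomial.mem_coeffsIn, MvPolynomial.coeffsIn_mul, MvPolynomial.coeffsIn_mul]
  refine Submodule.mul_mem_mul (Submodule.mul_mem_mul ?_ ?_) (MvPolynomial.le_coeffsIn_pow ?_)
  · exact MvPolynomial.C_mem_coeffsIn.mpr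
      (Submodule.pow_mem_pow _ (Submodule.mem_span_singleton_self h) d)
  · exact MvPolynomial.C_mem_coeffsIn.mpr (hb ⟨m, hm⟩)
  · have := Submodule.prod_pow_mem _ m.support y hy m
    rwa [← hf.degree_eq_sum_deg_support hm] at this

theorem exists_ne_zero_eval_eq_zero_of_basis {k K ι τ : Type*} [Field k] [IsAlgClosed k] [Field K]
    [Algebra k K] [Fintype ι] [Fintype τ] {x : K} (hx : Transcendental k x)
    (e : Module.Basis ι k⟮x⟯ K) {d : ℕ} {f : MvPolynomial τ K} (hf : f.IsHomogeneous d)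
    (hd : 1 ≤ d) (hdτ : d < Fintype.card τ) :
    ∃ a : τ → K, a ≠ 0 ∧ MvPolynomial.eval a f = 0 := by
  obtain ⟨g, hg, c, hc⟩ := exists_C_mul_bind₁_mem_coeffsIn hx e e.span_eq hf
  have hn : 0 < Fintype.card ι := Fintype.card_pos_iff.mpr e.index_nonempty
  let y (i : τ) : MvPolynomial (τ × (Fin (c + 1) × ι)) K :=
    ∑ p, MvPolynomial.X (i, p) * MvPolynomial.C (x ^ (p.1 : ℕ) * e p.2)
  have hy (i : τ) : y i ∈ MvPolynomial.coeffsIn _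
      (powersSpan k x c * Submodule.span k (Set.range e)) :=
    Submodule.sum_mem _ fun p _ ↦ MvPolynomial.X_mul_mem_coeffsIn.mpr <|
      MvPolynomial.C_mem_coeffsIn.mpr <| Submodule.mul_mem_mul
        (pow_mem_powersSpan x (Nat.lt_succ_iff.mp p.1.2)) (Submodule.subset_span ⟨p.2, rfl⟩)
  have heval (t : τ × (Fin (c + 1) × ι) → K) : MvPolynomial.eval t (MvPolynomial.bind₁ y f) =
      MvPolynomial.eval (fun i ↦ MvPolynomial.eval t (y i)) f :=
    MvPolynomial.eval₂Hom_bind₁ (RingHom.id K) t y f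
  have hfin : Module.Finite k
      ↥(powersSpan k x (c * d + c) * Submodule.span k (Set.range e)) := by
    rw [powersSpan_mul_span_range]
    exact Module.Finite.span_of_finite k (Set.finite_range _)
  have hf0 : MvPolynomial.eval 0 f = 0 := by
    rw [MvPolynomial.eval_zero, MvPolynomial.constantCoeff_eq]
    exact hf.coeff_eq_zero (by simp; omega)
  obtain ⟨t, ht, hft⟩ := MvPolynomial.exists_ne_zero_eval_algebraMap_eq_zero
    (V := powersSpan k x (c * d + c) * Submodule.span k (Set.range e))
    (p := MvPolynomial.C g * MvPolynomial.bind₁ y f) (by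
      refine (finrank_powersSpan_mul_span_range_le x _ e).trans_lt ?_
      rw [Nat.card_eq_fintype_card, Fintype.card_prod, Fintype.card_prod, Fintype.card_fin,
        ← mul_assoc]
      refine Nat.mul_lt_mul_of_pos_right ?_ hn
      nlinarith) (hc c y hy) (by
      rw [map_mul, heval]
      have : (fun i ↦ MvPolynomial.eval 0 (y i)) = 0 := by
        ext i
        simp [y]
      rw [this, hf0, mul_zero])
  refine ⟨fun i ↦ MvPolynomial.eval (fun j ↦ algebraMap k K (t j)) (y i), fun h0 ↦ ht ?_, ?_⟩
  · ext ⟨i, p⟩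
    refine Fintype.linearIndependent_iff.mp
      (linearIndependent_pow_mul x hx e.linearIndependent c) (fun p ↦ t (i, p)) ?_ p
    simpa [y, Algebra.smul_def] using congrFun h0 i
  · rw [map_mul, heval, MvPolynomial.eval_C] at hft
    exact (mul_eq_zero.mp hft).resolve_left hg

/-- **Tsen's theorem**: a function field of dimension 1 over an algebraically closed
field `k` (i.e. a finitely generated field extension of `k` of transcendence degree 1)
is quasi-algebraically closed. -/
theorem tsen_function_field_quasi_algebraically_closed
    (k K : Type*) [Field k] [IsAlgClosed k] [Field K] [Algebra k K]
    (hfg : ∃ s : Finset K, IntermediateField.adjoin k (s : Set K) = ⊤)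
    (htrdeg : ∃ x : K, IsTranscendenceBasis k (fun _ : Unit => x)) :
    ∀ N : ℕ, 1 ≤ N → ∀ (d : ℕ) (f : MvPolynomial (Fin N) K),
      f.IsHomogeneous d → 1 ≤ d → d < N →
      ∃ a : Fin N → K, a ≠ 0 ∧ MvPolynomial.eval a f = 0 := by
  obtain ⟨s, hs⟩ := hfg
  obtain ⟨x, hx⟩ := htrdeg
  have hxt : Transcendental k x := algebraicIndependent_unique_type_iff.mp hx.1
  have halg : Algebra.IsAlgebraic k⟮x⟯ K := by
    have := hx.isAlgebraic_field
    rwa [Set.range_const] at this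
  have htop : adjoin k⟮x⟯ (s : Set K) = ⊤ := adjoin_eq_top_of_adjoin_eq_top k hs
  have hfin : FiniteDimensional k⟮x⟯ K := by
    have : FiniteDimensional k⟮x⟯ (adjoin k⟮x⟯ (s : Set K)) :=
      finiteDimensional_adjoin fun z _ ↦ (halg.isAlgebraic z).isIntegral
    rw [htop] at this
    exact Module.Finite.equiv (topEquiv (F := k⟮x⟯) (E := K)).toLinearEquiv
  intro N _ d f hf hd hdN
  exact exists_ne_zero_eval_eq_zero_of_basis hxt (Module.finBasis k⟮x⟯ K) hf hd (by simpa using hdN)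
end

section
/- Let K be a quasi-algebraically closed field and let L/K be a finite Galois extension with Galois group G = Gal(L/K). Then the second group cohomology H²(G, Lˣ), where G acts on the multiplicative group Lˣ via field automorphisms, vanishes. -/
open MvPolynomial
open scoped Matrix

section Descent

variable {K L : Type*} [Field K] [Field L] [Algebra K L] [FiniteDimensional K L]

/-- Galois descent: the invariants of a semilinear action of the automorphism group span. -/
theorem span_invariants_eq_top {E : Type*} [AddCommGroup E] [Module L E]
    (ρ : Gal(L/K) → E → E) (hsmul : ∀ g (l : L) x, ρ g (l • x) = g l • ρ g x)
    (hadd : ∀ g x y, ρ g (x + y) = ρ g x + ρ g y)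
    (hmul : ∀ g h x, ρ g (ρ h x) = ρ (g * h) x) (hone : Function.Surjective (ρ 1)) :
    Submodule.span L {x | ∀ g, ρ g x = x} = ⊤ := by
  rw [eq_top_iff]
  intro x _
  by_contra hx
  obtain ⟨y, rfl⟩ := hone x
  obtain ⟨f, hfx, hf⟩ := Submodule.exists_le_ker_of_notMem hx
  have hsum : ∀ l : L, ∑ g : Gal(L/K), f (ρ g y) * g l = 0 := by
    intro l
    have hmem : ∑ g : Gal(L/K), g l • ρ g y ∈ {x | ∀ g, ρ g x = x} := by
      intro h
      have hs : ρ h (∑ g : Gal(L/K), g l • ρ g y) = ∑ g : Gal(L/K), ρ h (g l • ρ g y) :=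
        map_sum (AddMonoidHom.mk' (ρ h) (hadd h)) _ _
      rw [hs]
      refine Fintype.sum_bijective (fun g ↦ h * g) (Group.mulLeft_bijective h) _ _ fun g ↦ ?_
      rw [hsmul, hmul, AlgEquiv.mul_apply]
    have h0 := hf (Submodule.subset_span hmem)
    rw [LinearMap.mem_ker, map_sum] at h0
    simpa [mul_comm] using h0
  have hli : LinearIndependent L (fun g : Gal(L/K) ↦ (g : L → L)) :=
    (linearIndependent_monoidHom L L).comp (fun g : Gal(L/K) ↦ (g : L →* L)) fun g h hgh ↦ by
      ext l
      exact DFunLike.congr_fun hgh l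
  refine hfx (Fintype.linearIndependent_iff.1 hli (fun g ↦ f (ρ g y)) ?_ 1)
  funext l
  simpa using hsum l

end Descent

section DetForm

variable {K L : Type*} [Field K] [Field L] [Algebra K L] [FiniteDimensional K L] [IsGalois K L]

/-- A polynomial over `L` with Galois-invariant coefficients comes from `K`. -/
theorem MvPolynomial.exists_map_eq_of_galois_invariant {σ : Type*} (P : MvPolynomial σ L)
    (hP : ∀ g : Gal(L/K), map (g : L →+* L) P = P) :
    ∃ f : MvPolynomial σ K, map (algebraMap K L) f = P := by
  rw [← Set.mem_range, mem_range_map_iff_coeffs_subset]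
  intro a ha
  obtain ⟨m, -, rfl⟩ := mem_coeffs_iff.1 ha
  refine (IsGalois.mem_range_algebraMap_iff_fixed _).2 fun g ↦ ?_
  conv_rhs => rw [← hP g]
  exact (coeff_map (g : L →+* L) P m).symm

/-- The determinant of a generic linear combination of matrices that are invariant under a twisted
Galois action is a form over the base field. -/
theorem exists_isHomogeneous_eval_eq_det {ι n : Type*} [Fintype ι] [Fintype n] [DecidableEq n]
    (B : ι → Matrix n n L) (U : Gal(L/K) → Matrix n n L) (hU : ∀ g, IsUnit (U g))
    (hB : ∀ i g, B i * U g = U g * (B i).map g) :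
    ∃ f : MvPolynomial ι K, f.IsHomogeneous (Fintype.card n) ∧
      ∀ a : ι → K, algebraMap K L (eval a f) = (∑ i, algebraMap K L (a i) • B i).det := by
  set A : Matrix n n (MvPolynomial ι L) := ∑ k, (X k : MvPolynomial ι L) • (B k).map C with hA
  have hAapp : ∀ i j, A i j = ∑ k, X k * C (B k i j) := fun i j ↦ by
    simp [hA, Matrix.sum_apply]
  have hAg : ∀ g : Gal(L/K), A * (U g).map C = (U g).map C * A.map (map (g : L →+* L)) := by
    intro g
    have : A.map (map (g : L →+* L)) = ∑ k, (X k : MvPolynomial ι L) • ((B k).map g).map C := by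
      ext1 i j
      simp [hAapp, Matrix.sum_apply]
    rw [this, hA, Finset.sum_mul, Finset.mul_sum]
    refine Finset.sum_congr rfl fun k _ ↦ ?_
    rw [smul_mul_assoc, mul_smul_comm, ← Matrix.map_mul, ← Matrix.map_mul, hB]
  obtain ⟨f, hf⟩ := MvPolynomial.exists_map_eq_of_galois_invariant (K := K) A.det fun g ↦ by
    have hdet := congrArg Matrix.det (hAg g)
    have hu : IsUnit ((U g).map (C : L →+* MvPolynomial ι L)).det :=
      (Matrix.isUnit_iff_isUnit_det _).1 ((hU g).map (C : L →+* MvPolynomial ι L).mapMatrix)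
    rw [Matrix.det_mul, Matrix.det_mul, mul_comm] at hdet
    rw [RingHom.map_det]
    exact (hu.mul_left_cancel hdet).symm
  refine ⟨f, ?_, fun a ↦ ?_⟩
  · refine IsHomogeneous.of_map (algebraMap K L).injective ?_
    rw [hf, Matrix.det_apply]
    refine IsHomogeneous.sum _ _ _ fun σ _ ↦ ?_
    have hp : (∏ i, A (σ i) i).IsHomogeneous (Fintype.card n) := by
      have := IsHomogeneous.prod Finset.univ (fun i ↦ A (σ i) i) (fun _ ↦ 1) fun i _ ↦ by
        rw [hAapp]
        exact IsHomogeneous.sum _ _ _ fun k _ ↦ by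
          simpa using (isHomogeneous_X L k).mul (isHomogeneous_C ι (B k (σ i) i))
      simpa using this
    rcases Int.units_eq_one_or (Equiv.Perm.sign σ) with h | h
    · simpa [h] using hp
    · simpa [h] using hp.neg
  · rw [map_eval, hf, RingHom.map_det]
    congr 1
    ext1 i j
    simp [hAapp, Matrix.sum_apply, -algebraMap_smul]

end DetForm

section Twisted

variable {K L : Type*} [Field K] [Field L] [Algebra K L] [FiniteDimensional K L]

/-- Over a quasi-algebraically closed field, a twisted semilinear Galois representation all of whose
nonzero endomorphisms are invertible has dimension at most one. -/
theorem card_le_one_of_irreducible_twisted [IsGalois K L]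
    (hqac : ∀ N : ℕ, 1 ≤ N → ∀ (d : ℕ) (f : MvPolynomial (Fin N) K),
      f.IsHomogeneous d → 1 ≤ d → d < N →
      ∃ a : Fin N → K, a ≠ 0 ∧ MvPolynomial.eval a f = 0)
    {n : Type*} [Fintype n] [DecidableEq n] (U : Gal(L/K) → Matrix n n L)
    (hU : ∀ g, IsUnit (U g)) (c : Gal(L/K) → Gal(L/K) → L)
    (hmul : ∀ g h, U g * (U h).map g = c g h • U (g * h))
    (hirr : ∀ M : Matrix n n L, (∀ g, M * U g = U g * M.map g) → M.det = 0 → M = 0) :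
    Fintype.card n ≤ 1 := by
  by_contra! hcard
  have hinv : ∀ g, (U g)⁻¹ * U g = 1 := fun g ↦
    Matrix.nonsing_inv_mul _ ((Matrix.isUnit_iff_isUnit_det _).1 (hU g))
  let ρ : Gal(L/K) → Matrix n n L → Matrix n n L := fun g M ↦ U g * M.map g * (U g)⁻¹
  have hρ : ∀ g M, ρ g M * U g = U g * M.map g := fun g M ↦ by
    simp only [ρ, mul_assoc, hinv, mul_one]
  have hρ_iff : ∀ M, M ∈ {M | ∀ g, ρ g M = M} ↔ ∀ g, M * U g = U g * M.map g := fun M ↦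
    forall_congr' fun g ↦ by rw [← hρ, eq_comm, (hU g).mul_left_inj]
  have hspan : Submodule.span L {M | ∀ g, ρ g M = M} = ⊤ := by
    refine span_invariants_eq_top ρ (fun g l M ↦ ?_) (fun g M M' ↦ ?_) (fun g h M ↦ ?_) fun M ↦ ?_
    · have : (l • M).map g = g l • M.map g := by ext; simp
      simp only [ρ, this, mul_smul_comm, smul_mul_assoc]
    · have : (M + M').map g = M.map g + M'.map g := by ext; simp
      simp only [ρ, this, mul_add, add_mul]
    · have hmap : ∀ A B : Matrix n n L, (A * B).map g = A.map g * B.map g := fun A B ↦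
        Matrix.map_mul (f := (g : L →+* L))
      have hunit : IsUnit (U g * (U h).map g) :=
        (hU g).mul ((hU h).map (g : L →+* L).mapMatrix)
      rw [← hunit.mul_left_inj, ← mul_assoc, hρ, mul_assoc, ← hmap, hρ, hmap, ← mul_assoc, hmul,
        mul_smul_comm, hρ, smul_mul_assoc]
      congr 2
    · refine ⟨(U 1)⁻¹ * M * U 1, (hU 1).mul_left_inj.1 ?_⟩
      have : ∀ A : Matrix n n L, A.map (1 : Gal(L/K)) = A := fun A ↦ by ext; simp
      rw [hρ, this, ← mul_assoc, ← mul_assoc,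
        Matrix.mul_nonsing_inv _ ((Matrix.isUnit_iff_isUnit_det _).1 (hU 1)), one_mul]
  obtain ⟨b, hb, hbspan, hbli⟩ := exists_linearIndependent L {M | ∀ g, ρ g M = M}
  let e : Module.Basis b L (Matrix n n L) := Module.Basis.mk hbli (by
    rw [Subtype.range_coe, hbspan, hspan])
  have : Fintype b := Module.Basis.fintypeIndexOfRankLtAleph0 e (Module.rank_lt_aleph0 _ _)
  have hbcard : Fintype.card b = Fintype.card n * Fintype.card n := by
    rw [← Module.finrank_eq_card_basis e, Module.finrank_matrix, Module.finrank_self, mul_one]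
  let σ := (Fintype.equivFinOfCardEq hbcard).symm
  have hB : ∀ i g, (σ i : Matrix n n L) * U g = U g * (σ i : Matrix n n L).map g := fun i ↦
    (hρ_iff _).1 (hb (σ i).2)
  obtain ⟨f, hf, hfeval⟩ := exists_isHomogeneous_eval_eq_det
    (fun i ↦ (σ i : Matrix n n L)) U hU hB
  obtain ⟨a, ha, ha0⟩ := hqac _ (by nlinarith) _ f hf (by lia) (by nlinarith)
  have hdet := hfeval a
  rw [ha0, map_zero] at hdet
  have h0 := hirr _ (fun g ↦ ?_) hdet.symm
  · refine ha (funext fun i ↦ ?_)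
    have := Fintype.linearIndependent_iff.1 (hbli.comp σ σ.injective) _ h0 i
    simpa using this
  · have : (∑ i, algebraMap K L (a i) • (σ i : Matrix n n L)).map g =
        ∑ i, algebraMap K L (a i) • (σ i : Matrix n n L).map g := by
      ext
      simp [Matrix.sum_apply]
    rw [this, Finset.sum_mul, Finset.mul_sum]
    refine Finset.sum_congr rfl fun i _ ↦ ?_
    rw [smul_mul_assoc, mul_smul_comm, hB]

/-- For every 2-cocycle there is a nonzero twisted semilinear Galois representation all of whose
nonzero endomorphisms are invertible: a minimal subrepresentation of the twisted regular
representation. -/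
theorem exists_irreducible_twisted (c : Gal(L/K) → Gal(L/K) → L) (hc : ∀ g h, c g h ≠ 0)
    (hcoc : ∀ g h j, c (g * h) j * c g h = g (c h j) * c g (h * j)) :
    ∃ (s : ℕ) (U : Gal(L/K) → Matrix (Fin s) (Fin s) L), 0 < s ∧ (∀ g, IsUnit (U g)) ∧
      (∀ g h, U g * (U h).map g = c g h • U (g * h)) ∧
      ∀ M : Matrix (Fin s) (Fin s) L, (∀ g, M * U g = U g * M.map g) → M.det = 0 → M = 0 := by
  let T : Gal(L/K) → (Gal(L/K) → L) →+ (Gal(L/K) → L) := fun g ↦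
    AddMonoidHom.mk' (fun v k ↦ c g (g⁻¹ * k) * g (v (g⁻¹ * k))) fun v w ↦ by
      ext k
      simp [mul_add]
  have hTapp : ∀ g v k, T g v k = c g (g⁻¹ * k) * g (v (g⁻¹ * k)) := fun _ _ _ ↦ rfl
  have hTsmul : ∀ g (l : L) v, T g (l • v) = g l • T g v := fun g l v ↦ by
    ext k
    simp [hTapp, mul_left_comm]
  have hTmul : ∀ g h v, T g (T h v) = c g h • T (g * h) v := fun g h v ↦ by
    ext k
    have := hcoc g h (h⁻¹ * (g⁻¹ * k))
    rw [mul_inv_cancel_left] at this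
    simp only [hTapp, Pi.smul_apply, smul_eq_mul, map_mul, mul_inv_rev, mul_assoc,
      AlgEquiv.mul_apply] at this ⊢
    rw [← mul_assoc, mul_comm (c g _), ← this]
    ring
  have hTinj : ∀ g v, T g v = 0 → v = 0 := fun g v h ↦ by
    ext k
    have := congrFun h (g * k)
    simpa [hTapp, hc] using this
  obtain ⟨W, ⟨hW0, hWT⟩, hWmin⟩ := IsArtinian.set_has_minimal
    {W : Submodule L (Gal(L/K) → L) | W ≠ ⊥ ∧ ∀ g, ∀ v ∈ W, T g v ∈ W}
    ⟨⊤, top_ne_bot, fun _ _ _ ↦ Submodule.mem_top⟩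
  let b := Module.finBasis L W
  let t : Gal(L/K) → W → W := fun g w ↦ ⟨T g w, hWT g w w.2⟩
  let U : Gal(L/K) → Matrix (Fin (Module.finrank L W)) (Fin (Module.finrank L W)) L :=
    fun g ↦ Matrix.of fun i j ↦ b.repr (t g (b j)) i
  have hrepr : ∀ g w, b.repr (t g w) = U g *ᵥ (g ∘ b.repr w) := fun g w ↦ by
    have h1 : t g w = ∑ j, g (b.repr w j) • t g (b j) := by
      conv_lhs => rw [← b.sum_repr w]
      ext1
      simp only [t, AddSubmonoidClass.coe_finsetSum, Submodule.coe_smul, map_sum, hTsmul]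
    ext i
    rw [h1, map_sum, Finsupp.finsetSum_apply]
    refine Finset.sum_congr rfl fun j _ ↦ ?_
    rw [map_smul]
    exact mul_comm _ _
  refine ⟨Module.finrank L W, U, ?_, fun g ↦ ?_, fun g h ↦ ?_, fun M hM hdet ↦ ?_⟩
  · exact Module.finrank_pos_iff.2 (Submodule.nontrivial_iff_ne_bot.2 hW0)
  · rw [← Matrix.mulVec_injective_iff_isUnit]
    refine (injective_iff_map_eq_zero (Matrix.mulVecLin (U g))).2 fun v hv ↦ ?_
    have h1 := hrepr g (b.equivFun.symm (g.symm ∘ v))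
    have h2 : (g ∘ b.repr (b.equivFun.symm (g.symm ∘ v))) = v := by
      ext i
      have := congrFun (b.equivFun.apply_symm_apply (g.symm ∘ v)) i
      rw [Module.Basis.equivFun_apply] at this
      simp [-Module.Basis.equivFun_symm_apply, this]
    rw [h2] at h1
    have h3 : t g (b.equivFun.symm (g.symm ∘ v)) = 0 := by
      apply b.repr.injective
      ext i
      rw [h1]
      simpa using congrFun hv i
    have h4 : b.equivFun.symm (g.symm ∘ v) = 0 := Subtype.ext (hTinj g _ (congrArg Subtype.val h3))
    rw [h4] at h2
    rw [← h2]
    ext i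
    simp
  · have h1 : ∀ w, t g (t h w) = c g h • t (g * h) w := fun w ↦ Subtype.ext (hTmul g h w)
    ext i j
    have h2 := congrFun (hrepr g (t h (b j))) i
    rw [h1] at h2
    simpa [Matrix.mul_apply, Matrix.mulVec, dotProduct, U] using h2.symm
  · let φ := Matrix.toLin b b M
    have hφ : ∀ w, b.repr (φ w) = M *ᵥ b.repr w := fun w ↦ Matrix.repr_toLin b b M w
    have hφt : ∀ g w, φ (t g w) = t g (φ w) := fun g w ↦ by
      apply b.repr.injective
      apply DFunLike.coe_injective
      rw [hφ, hrepr, hrepr, hφ, Matrix.mulVec_mulVec, hM, ← Matrix.mulVec_mulVec]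
      congr 1
      ext i
      simp [Matrix.mulVec, dotProduct]
    by_contra hM0
    refine hWmin ((LinearMap.ker φ).map W.subtype) ⟨?_, ?_⟩ ?_
    · intro hmap
      have hker : LinearMap.ker φ = ⊥ :=
        Submodule.map_injective_of_injective W.injective_subtype (by rw [hmap, Submodule.map_bot])
      have hdet' : LinearMap.det φ ≠ 0 :=
        ((LinearEquiv.ofInjectiveEndo φ (LinearMap.ker_eq_bot.1 hker)).isUnit_det').ne_zero
      exact hdet' (by rw [← hdet]; exact LinearMap.det_toLin b M)
    · rintro g _ ⟨w, hw, rfl⟩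
      refine ⟨t g w, ?_, rfl⟩
      rw [SetLike.mem_coe, LinearMap.mem_ker] at hw ⊢
      rw [hφt, hw]
      exact Subtype.ext (map_zero (T g))
    · refine lt_of_le_of_ne (Submodule.map_subtype_le _ _) fun heq ↦ hM0 ?_
      have hker : LinearMap.ker φ = ⊤ := by
        refine Submodule.map_injective_of_injective W.injective_subtype ?_
        rw [heq, Submodule.map_subtype_top]
      exact (Matrix.toLin b b).map_eq_zero_iff.1 (LinearMap.ker_eq_top.1 hker)

end Twisted

/-- For a quasi-algebraically closed field `K` and a finite Galois extension `L/K`,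
the second group cohomology `H²(Gal(L/K), Lˣ)` vanishes. -/
theorem h2_galois_units_trivial_of_quasi_algebraically_closed
    (K L : Type) [Field K] [Field L] [Algebra K L]
    [FiniteDimensional K L] [IsGalois K L]
    (hqac : ∀ N : ℕ, 1 ≤ N → ∀ (d : ℕ) (f : MvPolynomial (Fin N) K),
      f.IsHomogeneous d → 1 ≤ d → d < N →
      ∃ a : Fin N → K, a ≠ 0 ∧ MvPolynomial.eval a f = 0) :
    Subsingleton (groupCohomology.H2 (Rep.ofAlgebraAutOnUnits K L)) := by
  refine subsingleton_of_forall_eq 0 fun y ↦ groupCohomology.H2_induction_on y fun x ↦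
    (groupCohomology.H2π_eq_zero_iff _).2
      (groupCohomology.coboundariesOfIsMulCoboundary₂ (G := Gal(L/K)) (M := Lˣ)
        (f := Additive.toMul ∘ x.1) ?_).2
  have hx := groupCohomology.isMulCocycle₂_of_mem_cocycles₂
    (G := Gal(L/K)) (M := Lˣ) _ x.2
  set f : Gal(L/K) × Gal(L/K) → Lˣ := Additive.toMul ∘ x.1
  obtain ⟨s, U, hs, hU, hmul, hirr⟩ := exists_irreducible_twisted (K := K)
    (fun g h ↦ (f (g, h) : L)) (fun g h ↦ (f (g, h)).ne_zero)
    fun g h j ↦ congrArg Units.val (hx g h j)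
  have hs1 := card_le_one_of_irreducible_twisted hqac U hU _ hmul hirr
  obtain rfl : s = 1 := by
    rw [Fintype.card_fin] at hs1
    lia
  have hu : ∀ g, U g 0 0 ≠ 0 := fun g ↦ by
    simpa [Matrix.isUnit_iff_isUnit_det] using hU g
  refine ⟨fun g ↦ Units.mk0 _ (hu g), fun g h ↦ ?_⟩
  have h00 := congrFun₂ (hmul g h) 0 0
  rw [div_mul_eq_mul_div, div_eq_iff_eq_mul]
  ext
  simpa [Matrix.mul_apply, mul_comm] using h00
end

section
/- Let K be a quasi-algebraically closed field and let L/K be a finite Galois extension whose Galois group G = Gal(L/K) is cyclic. Then the group cohomology Hʳ(G, Lˣ), where G acts on the multiplicative group Lˣ via field automorphisms, vanishes for all r ≥ 1. -/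
open CategoryTheory

theorem MvPolynomial.IsHomogeneous.det {R σ n : Type*} [CommRing R] [Fintype n] [DecidableEq n]
    (M : Matrix n n (MvPolynomial σ R)) (hM : ∀ i j, (M i j).IsHomogeneous 1) :
    M.det.IsHomogeneous (Fintype.card n) := by
  rw [Matrix.det_apply]
  refine MvPolynomial.IsHomogeneous.sum _ _ _ fun τ _ ↦ ?_
  have h : (∏ i, M (τ i) i).IsHomogeneous (∑ _i : n, 1) :=
    MvPolynomial.IsHomogeneous.prod _ _ _ fun i _ ↦ hM _ _
  rw [Finset.sum_const, Finset.card_univ, smul_eq_mul, mul_one] at h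
  rcases Int.units_eq_one_or (Equiv.Perm.sign τ) with h1 | h1
  · simpa [h1] using h
  · simpa [h1] using h.neg

/-- The norm of `∑ j, a j • b j` is given by a homogeneous polynomial in the coordinates `a`. -/
theorem Algebra.exists_isHomogeneous_eval_eq_norm {R S ι : Type*} [CommRing R] [CommRing S]
    [Algebra R S] [Fintype ι] (b : Module.Basis ι R S) :
    ∃ p : MvPolynomial ι R, p.IsHomogeneous (Fintype.card ι) ∧
      ∀ a : ι → R, MvPolynomial.eval a p = Algebra.norm R (∑ j, a j • b j) := by
  classical
  let M : Matrix ι ι (MvPolynomial ι R) :=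
    Matrix.of fun i k ↦ ∑ j, MvPolynomial.C (Algebra.leftMulMatrix b (b j) i k) * MvPolynomial.X j
  refine ⟨M.det, .det _ fun i k ↦ ?_, fun a ↦ ?_⟩
  · exact MvPolynomial.IsHomogeneous.sum _ _ _ fun j _ ↦
      MvPolynomial.isHomogeneous_C_mul_X _ _
  · rw [Algebra.norm_eq_matrix_det b, RingHom.map_det]
    congr 1
    ext i k
    simp [M, Matrix.sum_apply, mul_comm]

/-- Over a quasi-algebraically closed field, the norm of every finite extension is surjective. -/
theorem Algebra.norm_surjective_of_quasi_algebraically_closed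
    {K L : Type*} [Field K] [Field L] [Algebra K L] [FiniteDimensional K L]
    (hqac : ∀ N : ℕ, 1 ≤ N → ∀ (d : ℕ) (f : MvPolynomial (Fin N) K),
      f.IsHomogeneous d → 1 ≤ d → d < N →
      ∃ a : Fin N → K, a ≠ 0 ∧ MvPolynomial.eval a f = 0) :
    Function.Surjective (Algebra.norm K : L →* K) := by
  intro c
  set n := Module.finrank K L with hn
  have hn0 : 0 < n := Module.finrank_pos
  let b : Module.Basis (Fin n) K L := Module.finBasis K L
  obtain ⟨p, hp, hpe⟩ := Algebra.exists_isHomogeneous_eval_eq_norm b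
  rw [Fintype.card_fin] at hp
  obtain ⟨a, ha, ha0⟩ := hqac (n + 1) (by omega) n
    (MvPolynomial.rename Fin.castSucc p - MvPolynomial.C c * MvPolynomial.X (Fin.last n) ^ n)
    (hp.rename_isHomogeneous.sub (MvPolynomial.isHomogeneous_C_mul_X_pow _ _ _)) hn0 (by omega)
  set x : L := ∑ j, a j.castSucc • b j with hx
  set t := a (Fin.last n) with ht
  have hN : Algebra.norm K x = c * t ^ n := by
    simpa [MvPolynomial.eval_rename, hpe, sub_eq_zero] using ha0
  have ht0 : t ≠ 0 := by
    intro h0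
    rw [h0, zero_pow hn0.ne', mul_zero, Algebra.norm_eq_zero_iff] at hN
    refine ha (funext fun i ↦ ?_)
    induction i using Fin.lastCases with
    | last => exact h0
    | cast i => exact Fintype.linearIndependent_iff.1 b.linearIndependent _ hN i
  refine ⟨algebraMap K L t⁻¹ * x, ?_⟩
  rw [map_mul, hN, Algebra.norm_algebraMap, ← hn, inv_pow, mul_comm c,
    inv_mul_cancel_left₀ (pow_ne_zero n ht0)]

namespace Rep.FiniteCyclicGroup

universe u

variable {k G : Type u} [CommRing k] [CommGroup G] [Fintype G] (A : Rep k G) (g : G)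

theorem subsingleton_groupCohomology_of_odd (hg : ∀ x, x ∈ Subgroup.zpowers g)
    [Subsingleton (groupCohomology A 1)] {i : ℕ} (hi : Odd i) : Subsingleton (groupCohomology A i) :=
  (groupCohomologyIsoOdd A g hg i hi ≪≫
    (groupCohomologyIsoOdd A g hg 1 odd_one).symm).toLinearEquiv.toEquiv.subsingleton

theorem subsingleton_groupCohomology_of_even (hg : ∀ x, x ∈ Subgroup.zpowers g)
    (h : ∀ x : A, A.ρ g x = x → ∃ y : A, A.norm.hom y = x)
    {i : ℕ} (hi0 : i ≠ 0) (hi : Even i) : Subsingleton (groupCohomology A i) := by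
  have : NeZero i := ⟨hi0⟩
  have hex : (normHomCompSub A g).Exact := by
    rw [ShortComplex.moduleCat_exact_iff]
    intro x hx
    exact h x (by simpa [sub_hom, sub_eq_zero] using hx)
  have := ModuleCat.subsingleton_of_isZero
    ((ShortComplex.exact_iff_isZero_homology _).1 hex)
  exact (groupCohomologyIsoEven A g hg i hi).toLinearEquiv.toEquiv.subsingleton

end Rep.FiniteCyclicGroup

/-- For a quasi-algebraically closed field `K` and a finite Galois extension `L/K` with
cyclic Galois group, the group cohomology `Hʳ(Gal(L/K), Lˣ)` vanishes for all `r ≥ 1`. -/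
theorem cohomology_galois_units_trivial_of_quasi_algebraically_closed
    (K L : Type) [Field K] [Field L] [Algebra K L]
    [FiniteDimensional K L] [IsGalois K L] [IsCyclic (L ≃ₐ[K] L)]
    (hqac : ∀ N : ℕ, 1 ≤ N → ∀ (d : ℕ) (f : MvPolynomial (Fin N) K),
      f.IsHomogeneous d → 1 ≤ d → d < N →
      ∃ a : Fin N → K, a ≠ 0 ∧ MvPolynomial.eval a f = 0) :
    ∀ r : ℕ, 1 ≤ r →
      Subsingleton (groupCohomology (Rep.ofAlgebraAutOnUnits K L) r) := by
  intro r hr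
  obtain ⟨g, hg⟩ := IsCyclic.exists_generator (α := L ≃ₐ[K] L)
  let _ : CommGroup (L ≃ₐ[K] L) := IsCyclic.commGroup
  rcases Nat.even_or_odd r with he | ho
  · refine Rep.FiniteCyclicGroup.subsingleton_groupCohomology_of_even
      (Rep.ofAlgebraAutOnUnits K L) g hg (fun x hx ↦ ?_) (by omega) he
    let u : Lˣ := Additive.toMul x
    have hu : ∀ σ : L ≃ₐ[K] L, σ (u : L) = u := by
      have hgu : g (u : L) = u := congrArg (fun z : Additive Lˣ ↦ ((Additive.toMul z : Lˣ) : L)) hx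
      intro σ
      have hz : g ∈ MulAction.stabilizer (L ≃ₐ[K] L) (u : L) := hgu
      exact Subgroup.zpowers_le.2 hz (hg σ)
    obtain ⟨c, hc⟩ := (IsGalois.mem_range_algebraMap_iff_fixed (F := K) (u : L)).2 hu
    obtain ⟨y, hy⟩ := Algebra.norm_surjective_of_quasi_algebraically_closed (L := L) hqac c
    have hy0 : y ≠ 0 := by
      rintro rfl
      rw [Algebra.norm_zero] at hy
      rw [← hy, map_zero] at hc
      exact u.ne_zero hc.symm
    refine ⟨Additive.ofMul (Units.mk0 y hy0), ?_⟩
    have := groupCohomology.norm_ofAlgebraAutOnUnits_eq (K := K) (Units.mk0 y hy0)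
    rw [Units.val_mk0, hy, hc] at this
    exact congrArg Additive.ofMul (Units.ext this)
  · exact @Rep.FiniteCyclicGroup.subsingleton_groupCohomology_of_odd _ _ _ _ _
      (Rep.ofAlgebraAutOnUnits K L) g hg
      (inferInstanceAs (Subsingleton (groupCohomology.H1 (Rep.ofAlgebraAutOnUnits K L)))) r ho
end

section
/- Let G be a finite cyclic group of order d and let A be a G-module (an abelian group with a G-action). Let N_G : A → A be the norm map N_G(a) = Σ_{g ∈ G} g•a, let A^G be the subgroup of elements fixed by G, and let I_G A be the subgroup of A generated by the elements g•a − a for g ∈ G, a ∈ A. Then the group cohomology of G with coefficients in A satisfies: H⁰(G, A) ≅ A^G; Hʳ(G, A) ≅ ker(N_G)/I_G A for all odd r ≥ 1; and Hʳ(G, A) ≅ A^G/N_G(A) for all even r ≥ 2. -/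
open CategoryTheory

/-- The first isomorphism theorem for a surjection from a submodule `M` whose kernel is cut out by
an additive subgroup `J`, where `K` is `M` as an additive subgroup. -/
noncomputable def LinearMap.quotientAddSubgroupOfEquiv {k V H : Type*} [Ring k] [AddCommGroup V]
    [Module k V] [AddCommGroup H] [Module k H] {M : Submodule k V} {K J : AddSubgroup V}
    (hK : M.toAddSubgroup = K) (f : M →ₗ[k] H) (hf : Function.Surjective f)
    (hJ : ∀ x, f x = 0 ↔ (x : V) ∈ J) : (K ⧸ J.addSubgroupOf K) ≃+ H := by
  subst hK
  exact (QuotientAddGroup.quotientAddEquivOfEq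
    (AddSubgroup.ext fun x => (AddSubgroup.mem_addSubgroupOf.trans (hJ x).symm))).trans
    (QuotientAddGroup.quotientKerEquivOfSurjective f.toAddMonoidHom hf)

/-- For a finite cyclic group generated by `g`, the additive subgroup generated by all `ρ x a - a`
is the image of `ρ g - 1`. -/
lemma Representation.FiniteCyclicGroup.closure_sub_eq_range {k G V : Type*} [CommRing k] [Group G]
    [Finite G] [AddCommGroup V] [Module k V] (ρ : Representation k G V) {g : G}
    (hg : ∀ x, x ∈ Subgroup.zpowers g) :
    AddSubgroup.closure {x : V | ∃ (h : G) (a : V), x = ρ h a - a} =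
      (LinearMap.range (ρ g - LinearMap.id)).toAddSubgroup := by
  refine le_antisymm ?_ ?_
  · rw [← coinvariantsKer_eq_range ρ g hg, AddSubgroup.closure_le]
    rintro _ ⟨h, a, rfl⟩
    exact Coinvariants.sub_mem_ker h a
  · rintro _ ⟨a, rfl⟩
    exact AddSubgroup.subset_closure ⟨g, a, rfl⟩

namespace Rep.FiniteCyclicGroup

universe u

variable {k G : Type u} [CommRing k] [CommGroup G] [Fintype G] (A : Rep.{u} k G) (g : G)
  (hg : ∀ x, x ∈ Subgroup.zpowers g)

lemma groupCohomologyπEven_surjective (i : ℕ) [NeZero i] (hi : Even i) :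
    Function.Surjective (groupCohomologyπEven A g hg i hi) :=
  (ModuleCat.epi_iff_surjective _).1 (epi_comp' 
    (IsIso.epi_of_iso (ShortComplex.moduleCatCyclesIso _).inv) (epi_comp _ _))

lemma groupCohomologyπOdd_surjective (i : ℕ) (hi : Odd i) :
    Function.Surjective (groupCohomologyπOdd A g hg i hi) :=
  (ModuleCat.epi_iff_surjective _).1 (epi_comp' 
    (IsIso.epi_of_iso (ShortComplex.moduleCatCyclesIso _).inv) (epi_comp _ _))

variable {A : Type u} [AddCommGroup A] [Module k A] (ρ : Representation k G A)

/-- `Hⁱ(G, A)` for `i` odd, as a quotient of additive subgroups: the kernel of the norm modulo the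
image of `ρ(g) - 1`. -/
noncomputable def quotientAddEquivGroupCohomologyOdd (i : ℕ) (hi : Odd i) {K J : AddSubgroup A}
    (hK : (LinearMap.ker ρ.norm).toAddSubgroup = K)
    (hJ : (LinearMap.range (ρ g - LinearMap.id)).toAddSubgroup = J) :
    (K ⧸ J.addSubgroupOf K) ≃+ groupCohomology (Rep.of ρ) i :=
  LinearMap.quotientAddSubgroupOfEquiv hK (groupCohomologyπOdd (Rep.of ρ) g hg i hi).hom
    (groupCohomologyπOdd_surjective (Rep.of ρ) g hg i hi) fun x => by
      subst hJ
      exact groupCohomologyπOdd_eq_zero_iff (Rep.of ρ) g hg i hi x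

/-- `Hⁱ(G, A)` for nonzero even `i`, as a quotient of additive subgroups: the invariants modulo the
image of the norm. -/
noncomputable def quotientAddEquivGroupCohomologyEven (i : ℕ) [NeZero i] (hi : Even i)
    {K J : AddSubgroup A} (hK : ρ.invariants.toAddSubgroup = K)
    (hJ : (LinearMap.range ρ.norm).toAddSubgroup = J) :
    (K ⧸ J.addSubgroupOf K) ≃+ groupCohomology (Rep.of ρ) i :=
  LinearMap.quotientAddSubgroupOfEquiv (M := LinearMap.ker (ρ g - LinearMap.id))
    (hK ▸ AddSubgroup.ext fun x => by
      simpa [sub_eq_zero] using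
        (Representation.mem_invariants_iff_of_forall_mem_zpowers ρ g hg x).symm)
    (groupCohomologyπEven (Rep.of ρ) g hg i hi).hom
    (groupCohomologyπEven_surjective (Rep.of ρ) g hg i hi) fun x => by
      subst hJ
      exact groupCohomologyπEven_eq_zero_iff (Rep.of ρ) g hg i hi x

end Rep.FiniteCyclicGroup


/-- **2-periodicity of the cohomology of finite cyclic groups**: for a finite cyclic
group `G` of order `d` and a `G`-module `A`, `H⁰(G, A) ≅ A^G`, `Hʳ(G, A) ≅ ker N_G / I_G A`
for odd `r`, and `Hʳ(G, A) ≅ A^G / N_G(A)` for even `r ≥ 2`, where `N_G(a) = Σ_{g} g • a`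
is the norm, `A^G` the fixed points, and `I_G A` the subgroup generated by the `g • a - a`. -/
theorem groupCohomology_of_isCyclic
    (G : Type) [Group G] [Fintype G] [IsCyclic G] (d : ℕ) (hd : Fintype.card G = d)
    (A : Type) [AddCommGroup A] [DistribMulAction G A]
    (NG : A →+ A) (hNG : ∀ a : A, NG a = ∑ g : G, g • a)
    (AG : AddSubgroup A) (hAG : ∀ a : A, a ∈ AG ↔ ∀ g : G, g • a = a)
    (IGA : AddSubgroup A)
    (hIGA : IGA = AddSubgroup.closure {x : A | ∃ (g : G) (a : A), x = g • a - a}) :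
    Nonempty ((groupCohomology (Rep.ofDistribMulAction ℤ G A) 0) ≃+ AG) ∧
    (∀ r : ℕ, Odd r →
      Nonempty ((groupCohomology (Rep.ofDistribMulAction ℤ G A) r) ≃+
        (NG.ker ⧸ IGA.addSubgroupOf NG.ker))) ∧
    (∀ r : ℕ, 2 ≤ r → Even r →
      Nonempty ((groupCohomology (Rep.ofDistribMulAction ℤ G A) r) ≃+
        (AG ⧸ NG.range.addSubgroupOf AG))) := by
  obtain ⟨g, hg⟩ := IsCyclic.exists_generator (α := G)
  let ρ := Representation.ofDistribMulAction ℤ G A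
  have hnorm (a : A) : ρ.norm a = NG a := by
    rw [hNG]
    exact Representation.norm_ofDistribMulAction_eq (k := ℤ) a
  have hinv : ρ.invariants.toAddSubgroup = AG := AddSubgroup.ext fun a => (hAG a).symm
  have hker : (LinearMap.ker ρ.norm).toAddSubgroup = NG.ker :=
    AddSubgroup.ext fun a => by simp [AddMonoidHom.mem_ker, hnorm]
  have hrange : (LinearMap.range ρ.norm).toAddSubgroup = NG.range :=
    AddSubgroup.ext fun a => by simp [hnorm]
  have hI : (LinearMap.range (ρ g - LinearMap.id)).toAddSubgroup = IGA :=
    (Representation.FiniteCyclicGroup.closure_sub_eq_range ρ hg).symm.trans hIGA.symm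
  let _ : CommGroup G := IsCyclic.commGroup
  refine ⟨⟨(groupCohomology.H0Iso (Rep.of ρ)).toLinearEquiv.toAddEquiv.trans
    (AddEquiv.addSubgroupCongr hinv)⟩, fun r hr => ⟨?_⟩, fun r h2 hr => ⟨?_⟩⟩
  · exact (Rep.FiniteCyclicGroup.quotientAddEquivGroupCohomologyOdd g hg ρ r hr hker hI).symm
  · have : NeZero r := ⟨by lia⟩
    exact (Rep.FiniteCyclicGroup.quotientAddEquivGroupCohomologyEven g hg ρ r hr hinv hrange).symm
end
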